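/- arXiv:1510.07542 — 3 statements merged into one kernel-verified Lean document; each statement's English description precedes it below -/
import Mathlib

section
/- Let n ≥ 1, let a₁, …, aₙ > 0, and set h(x,z) = z² − Σ_{i=1}^n xᵢ²/aᵢ². Let f : ℝⁿ → ℝ be twice continuously differentiable with f(x) > √(Σ_{i=1}^n xᵢ²/aᵢ²) for all x (so the graph of f lies inside the upper cone {(x,z) : z > 0, h(x,z) ≥ 0}). Assume that for every x̄ ∈ ℝⁿ, writing p̄ᵢ = ∂f/∂xᵢ(x̄) and z̄ = f(x̄), one has 1 − Σ_{i=1}^n aᵢ²p̄ᵢ² > 0 and z̄ − Σ_{i=1}^n p̄ᵢx̄ᵢ ≥ 0, and that there is a constant V > 0 such that the (n+1)-dimensional Lebesgue measure of {(x,z) ∈ ℝⁿ × ℝ : z ≥ 0, Σ_{i=1}^n xᵢ²/aᵢ² ≤ z², z ≤ z̄ + Σ_{i=1}^n p̄ᵢ(xᵢ − x̄ᵢ)} equals V for all x̄. Then there is k > 0 with V = a₁⋯aₙ · (π^{n/2} / Γ(n/2 + 1)) · k^{n+1}/(n + 1) and f(x) = √(k² + Σ_{i=1}^n xᵢ²/aᵢ²)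 for all x, i.e. the graph of f is the upper sheet of the two-sheeted hyperboloid h(x,z) = k². -/
open MeasureTheory

open scoped RealInnerProductSpace Gradient

lemma one_sub_norm_sq_pos {E : Type*} [NormedAddCommGroup E] {p : E} (hp : ‖p‖ < 1) :
    0 < 1 - ‖p‖ ^ 2 := by
  nlinarith [norm_nonneg p]

section Clairaut

variable {E : Type*} [NormedAddCommGroup E] [InnerProductSpace ℝ E]

/-- The point of the upper hyperboloid sheet `z = √(k² + ‖x‖²)` where the gradient is `p`. -/
noncomputable def hyperboloidPoint (k : ℝ) (p : E) : E := (k / √(1 - ‖p‖ ^ 2)) • p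

lemma contDiffOn_hyperboloidPoint (k : ℝ) :
    ContDiffOn ℝ 1 (hyperboloidPoint k : E → E) (Metric.ball 0 1) := by
  have h : ∀ p ∈ Metric.ball (0 : E) 1, 1 - ‖p‖ ^ 2 ≠ 0 := fun p hp =>
    (one_sub_norm_sq_pos (by simpa using hp)).ne'
  have hs : ContDiffOn ℝ 1 (fun p : E => √(1 - ‖p‖ ^ 2)) (Metric.ball 0 1) :=
    (contDiff_const.sub (contDiff_norm_sq ℝ)).contDiffOn.sqrt h
  refine ContDiffOn.smul (contDiffOn_const.div hs fun p hp => ?_) contDiffOn_id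
  exact (Real.sqrt_pos.2 (one_sub_norm_sq_pos (by simpa using hp))).ne'

lemma hasFDerivAt_mul_sqrt_one_sub_norm_sq (k : ℝ) {p : E} (hp : ‖p‖ < 1) :
    HasFDerivAt (fun p : E => k * √(1 - ‖p‖ ^ 2)) (-(innerSL ℝ (hyperboloidPoint k p))) p := by
  have h0 := one_sub_norm_sq_pos hp
  have h1 : HasFDerivAt (fun p : E => 1 - ‖p‖ ^ 2) (-(2 • innerSL ℝ p)) p :=
    (hasStrictFDerivAt_norm_sq p).hasFDerivAt.const_sub 1
  refine ((h1.sqrt h0.ne').const_mul k).congr_fderiv ?_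
  ext v
  have := (Real.sqrt_pos.2 h0).ne'
  simp [hyperboloidPoint]
  field_simp

variable [CompleteSpace E] {f : E → ℝ}

lemma ContDiff.gradient_of_two (hf : ContDiff ℝ 2 f) : ContDiff ℝ 1 (∇ f) :=
  (InnerProductSpace.toDual ℝ E).symm.contDiff.comp (hf.fderiv_right (by norm_num))

lemma inner_gradient_eq_fderiv (f : E → ℝ) (x v : E) : ⟪∇ f x, v⟫ = fderiv ℝ f x v := by
  simp [gradient]

lemma inner_fderiv_gradient_comm (hf : ContDiff ℝ 2 f) (x u v : E) :
    ⟪fderiv ℝ (∇ f) x u, v⟫ = ⟪fderiv ℝ (∇ f) x v, u⟫ := by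
  have key : ∀ u v, ⟪fderiv ℝ (∇ f) x u, v⟫ = fderiv ℝ (fderiv ℝ f) x u v := by
    intro u v
    have hP := (hf.gradient_of_two.differentiable (by norm_num) x).hasFDerivAt
    have h1 := ((innerSL ℝ (E := E)).hasFDerivAt).comp x hP
    have h2 : fderiv ℝ f = innerSL ℝ ∘ ∇ f := by
      ext y w
      simp
    rw [h2, h1.fderiv]
    rfl
  rw [key, key]
  exact (hf.contDiffAt.isSymmSndFDerivAt (by simp)) u v

/-- Differentiating a Clairaut equation: the Hessian kills the characteristic direction. -/
lemma fderiv_gradient_sub_hyperboloidPoint (hf : ContDiff ℝ 2 f) {k : ℝ}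
    (hslope : ∀ x, ‖∇ f x‖ < 1)
    (hcl : ∀ x, f x - ⟪∇ f x, x⟫ = k * √(1 - ‖∇ f x‖ ^ 2)) (x : E) :
    fderiv ℝ (∇ f) x (x - hyperboloidPoint k (∇ f x)) = 0 := by
  refine ext_inner_right ℝ fun v => ?_
  have hP : HasFDerivAt (∇ f) (fderiv ℝ (∇ f) x) x :=
    (hf.gradient_of_two.differentiable (by norm_num) x).hasFDerivAt
  have hL := ((hf.differentiable (by norm_num) x).hasFDerivAt).sub (hP.inner ℝ (hasFDerivAt_id x))
  have hR := (hasFDerivAt_mul_sqrt_one_sub_norm_sq k (hslope x)).comp x hP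
  have h := hL.unique (hR.congr_of_eventuallyEq (Filter.Eventually.of_forall hcl))
  have hv := DFunLike.congr_fun h v
  rw [inner_fderiv_gradient_comm hf, inner_sub_right, inner_zero_left]
  simp [fderivInnerCLM_apply] at hv
  rw [real_inner_comm (hyperboloidPoint k _)]
  linarith

/-- The gradient is constant along the characteristic rays. -/
lemma gradient_const_on_ray [FiniteDimensional ℝ E] (hf : ContDiff ℝ 2 f) {k : ℝ}
    (hslope : ∀ x, ‖∇ f x‖ < 1)
    (hcl : ∀ x, f x - ⟪∇ f x, x⟫ = k * √(1 - ‖∇ f x‖ ^ 2)) (x : E) {s : ℝ} (hs : 0 ≤ s) :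
    ∇ f (x + s • (x - hyperboloidPoint k (∇ f x))) = ∇ f x := by
  set q := hyperboloidPoint k (∇ f x) with hq
  set X : ℝ → E := fun t => x + t • (x - q) with hX
  have hXc : Continuous X := by fun_prop
  have hgc : Continuous (∇ f) := hf.gradient_of_two.continuous
  have hHc : Continuous (fderiv ℝ (∇ f)) := hf.gradient_of_two.continuous_fderiv (by norm_num)
  obtain ⟨t₁, -, ht₁⟩ := (isCompact_Icc (a := 0) (b := s)).exists_isMaxOn ⟨0, by simp [hs]⟩
    ((hgc.comp hXc).norm.continuousOn)
  obtain ⟨t₂, -, ht₂⟩ := (isCompact_Icc (a := 0) (b := s)).exists_isMaxOn ⟨0, by simp [hs]⟩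
    ((hHc.comp hXc).norm.continuousOn)
  set r := ‖∇ f (X t₁)‖ with hr
  set M := ‖fderiv ℝ (∇ f) (X t₂)‖ with hM
  obtain ⟨K, hK⟩ := ((contDiffOn_hyperboloidPoint (E := E) k).mono
    (Metric.closedBall_subset_ball (hslope (X t₁)))).exists_lipschitzOnWith (by norm_num)
    (convex_closedBall 0 r) (isCompact_closedBall 0 r)
  have hball : ∀ t ∈ Set.Icc 0 s, ∇ f (X t) ∈ Metric.closedBall (0 : E) r := fun t ht => by
    simpa using ht₁ ht
  have hX0 : X 0 = x := by simp [hX]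
  have hderiv : ∀ t, HasDerivAt (fun t => ∇ f (X t) - ∇ f x) (fderiv ℝ (∇ f) (X t) (x - q)) t := by
    intro t
    have h1 : HasDerivAt X (x - q) t :=
      (((hasDerivAt_id t).smul_const (x - q)).const_add x).congr_deriv (by simp)
    exact ((hf.gradient_of_two.differentiable (by norm_num) _).hasFDerivAt.comp_hasDerivAt t
      h1).sub_const _
  have hmain := eq_zero_of_abs_deriv_le_mul_abs_self_of_eq_zero_right
    (f := fun t => ∇ f (X t) - ∇ f x) (K := M * K) (a := 0) (b := s)
    (by fun_prop) (fun t _ => (hderiv t).hasDerivWithinAt) (by simp [hX0]) ?_ s ⟨hs, le_rfl⟩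
  · exact sub_eq_zero.1 hmain
  · intro t ht
    have ht' : t ∈ Set.Icc 0 s := ⟨ht.1, ht.2.le⟩
    have h1 : (1 + t) • fderiv ℝ (∇ f) (X t) (x - q) =
        fderiv ℝ (∇ f) (X t) (hyperboloidPoint k (∇ f (X t)) - q) := by
      rw [← map_smul, ← sub_eq_zero, ← map_sub]
      convert fderiv_gradient_sub_hyperboloidPoint hf hslope hcl (X t) using 2
      simp only [hX]
      module
    have h2 : ‖fderiv ℝ (∇ f) (X t) (hyperboloidPoint k (∇ f (X t)) - q)‖ ≤
        M * (K * ‖∇ f (X t) - ∇ f x‖) := by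
      refine (ContinuousLinearMap.le_opNorm _ _).trans ?_
      gcongr
      · exact ht₂ ht'
      · exact hK.norm_sub_le (hball t ht') (by simpa [hX0] using hball 0 ⟨le_rfl, hs⟩)
    rw [← h1, norm_smul, Real.norm_of_nonneg (by linarith [ht.1])] at h2
    have := norm_nonneg (fderiv ℝ (∇ f) (X t) (x - q))
    nlinarith [ht.1]

/-- A `C²` solution of the Clairaut equation of the hyperboloid lying above the light cone is
the hyperboloid. -/
theorem eq_sqrt_of_clairaut [FiniteDimensional ℝ E] (hf : ContDiff ℝ 2 f) {k : ℝ} (hk : 0 < k)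
    (hcone : ∀ x, ‖x‖ < f x) (hslope : ∀ x, ‖∇ f x‖ < 1)
    (hcl : ∀ x, f x - ⟪∇ f x, x⟫ = k * √(1 - ‖∇ f x‖ ^ 2)) (x : E) :
    f x = √(k ^ 2 + ‖x‖ ^ 2) := by
  have hD := one_sub_norm_sq_pos (hslope x)
  set p := ∇ f x with hp
  set d := x - hyperboloidPoint k p with hd
  set g := k * √(1 - ‖p‖ ^ 2) with hg
  have hbound : ∀ s : ℝ, 0 ≤ s → (1 - ‖p‖) * (s * ‖d‖ - ‖x‖) ≤ g := by
    intro s hs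
    have h1 := gradient_const_on_ray hf hslope hcl x hs
    have h2 := hcl (x + s • d)
    rw [h1] at h2
    have h3 := hcone (x + s • d)
    have h4 := real_inner_le_norm p (x + s • d)
    have h5 : s * ‖d‖ - ‖x‖ ≤ ‖x + s • d‖ := by
      have := norm_sub_le (x + s • d) x
      rw [add_sub_cancel_left, norm_smul, Real.norm_of_nonneg hs] at this
      linarith
    nlinarith [hslope x]
  have hd0 : d = 0 := by
    by_contra hne
    have hdpos : 0 < (1 - ‖p‖) * ‖d‖ := mul_pos (by linarith [hslope x]) (norm_pos_iff.2 hne)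
    have hg0 : 0 ≤ g := by positivity
    have hx0 : 0 ≤ (1 - ‖p‖) * ‖x‖ := mul_nonneg (by linarith [hslope x]) (norm_nonneg x)
    have := hbound ((g + (1 - ‖p‖) * ‖x‖ + 1) / ((1 - ‖p‖) * ‖d‖)) (by positivity)
    have h6 := div_mul_cancel₀ (g + (1 - ‖p‖) * ‖x‖ + 1) hdpos.ne'
    nlinarith
  have hx : x = hyperboloidPoint k p := sub_eq_zero.1 hd0
  have hcx := hcl x
  rw [eq_comm, Real.sqrt_eq_iff_mul_self_eq (by positivity) ((norm_nonneg x).trans (hcone x).le)]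
  have hS := Real.sq_sqrt hD.le
  have hS0 := Real.sqrt_pos.2 hD
  have hin : ⟪p, x⟫ = k / √(1 - ‖p‖ ^ 2) * ‖p‖ ^ 2 := by
    rw [hx, hyperboloidPoint, inner_smul_right, real_inner_self_eq_norm_sq]
  have hnx : ‖x‖ ^ 2 = (k / √(1 - ‖p‖ ^ 2)) ^ 2 * ‖p‖ ^ 2 := by
    conv_lhs => rw [hx, hyperboloidPoint, norm_smul]
    rw [mul_pow, Real.norm_eq_abs, sq_abs]
  have hfx : f x = k * √(1 - ‖p‖ ^ 2) + k / √(1 - ‖p‖ ^ 2) * ‖p‖ ^ 2 := by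
    rw [← hin]; linarith
  rw [hfx, hnx]
  set S := √(1 - ‖p‖ ^ 2)
  have hpS : ‖p‖ ^ 2 = 1 - S ^ 2 := by linarith
  rw [hpS]
  field_simp
  ring

end Clairaut

section ConeVolume

section Boost

variable {E : Type*} [NormedAddCommGroup E] [InnerProductSpace ℝ E]

/-- The square root of the quadratic form `‖y‖² - ⟪p, y⟫²`. -/
noncomputable def boostSpatial (p : E) : E →ₗ[ℝ] E :=
  LinearMap.transvection (-(1 + √(1 - ‖p‖ ^ 2))⁻¹ • innerₗ E p) p

lemma boostSpatial_apply (p y : E) :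
    boostSpatial p y = y - ((1 + √(1 - ‖p‖ ^ 2))⁻¹ * ⟪p, y⟫) • p := by
  simp [boostSpatial, LinearMap.transvection.apply, sub_eq_add_neg]

lemma det_boostSpatial [FiniteDimensional ℝ E] {p : E} (hp : ‖p‖ < 1) :
    LinearMap.det (boostSpatial p) = √(1 - ‖p‖ ^ 2) := by
  have hS := Real.sq_sqrt (one_sub_norm_sq_pos hp).le
  have hS0 := Real.sqrt_nonneg (1 - ‖p‖ ^ 2)
  rw [boostSpatial, LinearMap.transvection.det]
  simp only [LinearMap.smul_apply, innerₗ_apply_apply, real_inner_self_eq_norm_sq, smul_eq_mul]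
  set S := √(1 - ‖p‖ ^ 2)
  have hpS : ‖p‖ ^ 2 = 1 - S ^ 2 := by linarith
  rw [hpS]
  field_simp
  ring

lemma norm_sq_boostSpatial_sub {p : E} (hp : ‖p‖ < 1) (t : ℝ) (y : E) :
    ‖boostSpatial p y - (t / √(1 - ‖p‖ ^ 2)) • p‖ ^ 2 - (t / √(1 - ‖p‖ ^ 2)) ^ 2 =
      ‖y‖ ^ 2 - (t + ⟪p, y⟫) ^ 2 := by
  have hS := Real.sq_sqrt (one_sub_norm_sq_pos hp).le
  have hS0 := Real.sqrt_pos.2 (one_sub_norm_sq_pos hp)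
  rw [boostSpatial_apply, sub_sub, ← add_smul, norm_sub_sq_real, inner_smul_right, norm_smul,
    mul_pow, Real.norm_eq_abs, sq_abs, real_inner_comm]
  set S := √(1 - ‖p‖ ^ 2)
  have hpS : ‖p‖ ^ 2 = 1 - S ^ 2 := by linarith
  rw [hpS]
  field_simp
  ring

lemma norm_le_iff_boostSpatial_mem {p : E} (hp : ‖p‖ < 1) {t : ℝ} (ht : 0 ≤ t) (y : E) :
    ‖y‖ ≤ t + ⟪p, y⟫ ↔
      boostSpatial p y ∈ Metric.closedBall ((t / √(1 - ‖p‖ ^ 2)) • p) (t / √(1 - ‖p‖ ^ 2)) := by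
  have h := norm_sq_boostSpatial_sub hp t y
  have ht' : 0 ≤ t / √(1 - ‖p‖ ^ 2) := by positivity
  rw [mem_closedBall_iff_norm, ← sq_le_sq₀ (norm_nonneg (_ - _)) ht',
    ← sub_nonpos (b := _ ^ 2), h, sub_nonpos, sq_le_sq, abs_of_nonneg (norm_nonneg y)]
  refine ⟨fun hy => hy.trans (le_abs_self _), fun hy => ?_⟩
  rcases le_abs.1 hy with hy | hy
  · exact hy
  · have h1 := neg_le_of_abs_le (abs_real_inner_le_norm p y)
    have h2 : ‖y‖ = 0 := by nlinarith [norm_nonneg y]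
    rw [norm_eq_zero] at h2
    simp [h2, ht]

end Boost

/-- The volume of the unit Euclidean ball of dimension `n`. -/
noncomputable def ballConst (n : ℕ) : ℝ := √Real.pi ^ n / Real.Gamma ((n : ℝ) / 2 + 1)

lemma ballConst_pos (n : ℕ) : 0 < ballConst n :=
  div_pos (by positivity) (Real.Gamma_pos_of_pos (by positivity))

variable {n : ℕ}

/-- The slice of the linear image of the light cone by a translate of its tangent hyperplane. -/
lemma volume_norm_le_add_inner [Nonempty (Fin n)]
    {T : EuclideanSpace ℝ (Fin n) →ₗ[ℝ] EuclideanSpace ℝ (Fin n)} (hT : LinearMap.det T ≠ 0)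
    {p : EuclideanSpace ℝ (Fin n)} (hp : ‖p‖ < 1) {t : ℝ} (ht : 0 ≤ t) :
    volume {x | ‖T x‖ ≤ t + ⟪p, T x⟫} =
      ENNReal.ofReal (|LinearMap.det T|⁻¹ * ballConst n / √(1 - ‖p‖ ^ 2) ^ (n + 1) * t ^ n) := by
  have hS0 := Real.sqrt_pos.2 (one_sub_norm_sq_pos hp)
  have hset : {x | ‖T x‖ ≤ t + ⟪p, T x⟫} = (boostSpatial p ∘ₗ T) ⁻¹'
      Metric.closedBall ((t / √(1 - ‖p‖ ^ 2)) • p) (t / √(1 - ‖p‖ ^ 2)) := by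
    ext x
    exact norm_le_iff_boostSpatial_mem hp ht (T x)
  have hdet : LinearMap.det (boostSpatial p ∘ₗ T) = √(1 - ‖p‖ ^ 2) * LinearMap.det T := by
    rw [LinearMap.det_comp, det_boostSpatial hp]
  rw [hset, Measure.addHaar_preimage_linearMap _ (by rw [hdet]; exact mul_ne_zero hS0.ne' hT),
    hdet, EuclideanSpace.volume_closedBall, Fintype.card_fin, ← ENNReal.ofReal_pow (by positivity),
    ← ENNReal.ofReal_mul (by positivity), ← ENNReal.ofReal_mul (by positivity), abs_inv, abs_mul,
    abs_of_pos hS0, ballConst]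
  congr 1
  have := abs_pos.2 hT
  rw [div_pow]
  field_simp
  ring

/-- The volume cut off from a linear image of the light cone by a spacelike hyperplane. -/
theorem volume_cone_inter_halfSpace [Nonempty (Fin n)]
    {T : EuclideanSpace ℝ (Fin n) →ₗ[ℝ] EuclideanSpace ℝ (Fin n)} (hT : LinearMap.det T ≠ 0)
    {p : EuclideanSpace ℝ (Fin n)} (hp : ‖p‖ < 1) {c : ℝ} (hc : 0 ≤ c) :
    volume {w : EuclideanSpace ℝ (Fin n) × ℝ |
        0 ≤ w.2 ∧ ‖T w.1‖ ^ 2 ≤ w.2 ^ 2 ∧ w.2 ≤ c + ⟪p, T w.1⟫} =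
      ENNReal.ofReal (|LinearMap.det T|⁻¹ * ballConst n *
        (c / √(1 - ‖p‖ ^ 2)) ^ (n + 1) / (n + 1)) := by
  have hTc : Continuous T := T.continuous_of_finiteDimensional
  have hmeas : MeasurableSet {w : EuclideanSpace ℝ (Fin n) × ℝ |
      ‖T w.1‖ ≤ w.2 + ⟪p, T w.1⟫ ∧ w.2 ≤ c} :=
    ((isClosed_le (f := fun w : EuclideanSpace ℝ (Fin n) × ℝ => ‖T w.1‖)
      (g := fun w => w.2 + ⟪p, T w.1⟫) (by fun_prop) (by fun_prop)).inter
      (isClosed_le (f := fun w : EuclideanSpace ℝ (Fin n) × ℝ => w.2)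
      (g := fun _ => c) (by fun_prop) (by fun_prop))).measurableSet
  have hshear : MeasurePreserving
      (fun w : EuclideanSpace ℝ (Fin n) × ℝ => (w.1, w.2 - ⟪p, T w.1⟫))
      (volume.prod volume) (volume.prod volume) := by
    refine (MeasurePreserving.id volume).skew_product
      (g := fun (x : EuclideanSpace ℝ (Fin n)) (z : ℝ) => z - ⟪p, T x⟫) ?_ ?_
    · exact Continuous.measurable (by unfold Function.uncurry; fun_prop)
    · exact Filter.Eventually.of_forall fun x =>
        (measurePreserving_sub_right volume (⟪p, T x⟫)).map_eq
  have hset : {w : EuclideanSpace ℝ (Fin n) × ℝ |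
        0 ≤ w.2 ∧ ‖T w.1‖ ^ 2 ≤ w.2 ^ 2 ∧ w.2 ≤ c + ⟪p, T w.1⟫} =
      (fun w : EuclideanSpace ℝ (Fin n) × ℝ => (w.1, w.2 - ⟪p, T w.1⟫)) ⁻¹'
        {w | ‖T w.1‖ ≤ w.2 + ⟪p, T w.1⟫ ∧ w.2 ≤ c} := by
    ext ⟨x, z⟩
    simp only [Set.mem_ofPred_eq, Set.mem_preimage, sub_add_cancel, sub_le_iff_le_add]
    constructor
    · rintro ⟨h1, h2, h3⟩
      exact ⟨(sq_le_sq₀ (norm_nonneg _) h1).1 h2, h3⟩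
    · rintro ⟨h1, h2⟩
      have h3 := (norm_nonneg _).trans h1
      exact ⟨h3, (sq_le_sq₀ (norm_nonneg _) h3).2 h1, h2⟩
  have hslice : ∀ t : ℝ, volume ((fun x => (x, t)) ⁻¹' {w : EuclideanSpace ℝ (Fin n) × ℝ |
      ‖T w.1‖ ≤ w.2 + ⟪p, T w.1⟫ ∧ w.2 ≤ c}) = (Set.Icc 0 c).indicator (fun t => ENNReal.ofReal
        (|LinearMap.det T|⁻¹ * ballConst n / √(1 - ‖p‖ ^ 2) ^ (n + 1) * t ^ n)) t := by
    intro t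
    by_cases ht : t ∈ Set.Icc 0 c
    · rw [Set.indicator_of_mem ht, ← volume_norm_le_add_inner hT hp ht.1]
      simp [Set.preimage, ht.2]
    · rw [Set.indicator_of_notMem ht]
      convert measure_empty (μ := volume)
      ext x
      simp only [Set.mem_preimage, Set.mem_ofPred_eq, Set.mem_empty_iff_false, iff_false, not_and]
      intro h1 h2
      refine ht ⟨?_, h2⟩
      have := real_inner_le_norm p (T x)
      nlinarith [norm_nonneg (T x)]
  have hb := ballConst_pos n
  have hS0 := Real.sqrt_pos.2 (one_sub_norm_sq_pos hp)
  rw [hset, Measure.volume_eq_prod, hshear.measure_preimage hmeas.nullMeasurableSet,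
    Measure.prod_apply_symm hmeas, lintegral_congr hslice, lintegral_indicator measurableSet_Icc,
    ← ofReal_integral_eq_lintegral_ofReal]
  · rw [integral_Icc_eq_integral_Ioc, ← intervalIntegral.integral_of_le hc,
      intervalIntegral.integral_const_mul, integral_pow]
    congr 1
    have := abs_pos.2 hT
    rw [div_pow]
    field_simp
    simp
  · exact Continuous.integrableOn_Icc (by fun_prop)
  · filter_upwards [ae_restrict_mem measurableSet_Icc] with t ht
    have := ht.1
    simp only [Pi.zero_apply]
    positivity

end ConeVolume

section Rescaling

variable {n : ℕ}

/-- The diagonal linear map of `ℝⁿ` with coefficients `d`. -/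
noncomputable def diagMap (d : Fin n → ℝ) :
    EuclideanSpace ℝ (Fin n) →ₗ[ℝ] EuclideanSpace ℝ (Fin n) :=
  Matrix.toEuclideanLin (Matrix.diagonal d)

lemma diagMap_apply (d : Fin n → ℝ) (x : EuclideanSpace ℝ (Fin n)) (i : Fin n) :
    diagMap d x i = d i * x i := by
  simp [diagMap, Matrix.toLpLin_apply, Matrix.mulVec_diagonal]

lemma det_diagMap (d : Fin n → ℝ) : LinearMap.det (diagMap d) = ∏ i, d i := by
  rw [diagMap, Matrix.toEuclideanLin, Matrix.toLpLin_eq_toLin, LinearMap.det_toLin, Matrix.det_diagonal]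

lemma norm_sq_diagMap_inv (a : Fin n → ℝ) (x : EuclideanSpace ℝ (Fin n)) :
    ‖diagMap (fun i => (a i)⁻¹) x‖ ^ 2 = ∑ i, (x i) ^ 2 / (a i) ^ 2 := by
  rw [EuclideanSpace.real_norm_sq_eq]
  refine Finset.sum_congr rfl fun i _ => ?_
  rw [diagMap_apply, mul_pow, inv_pow, div_eq_inv_mul]

lemma diagMap_diagMap_inv {a : Fin n → ℝ} (ha : ∀ i, 0 < a i) (x : EuclideanSpace ℝ (Fin n)) :
    diagMap a (diagMap (fun i => (a i)⁻¹) x) = x := by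
  ext i
  rw [diagMap_apply, diagMap_apply, mul_inv_cancel_left₀ (ha i).ne']

lemma diagMap_inv_diagMap {a : Fin n → ℝ} (ha : ∀ i, 0 < a i) (x : EuclideanSpace ℝ (Fin n)) :
    diagMap (fun i => (a i)⁻¹) (diagMap a x) = x := by
  ext i
  rw [diagMap_apply, diagMap_apply, inv_mul_cancel_left₀ (ha i).ne']

lemma gradient_comp_diagMap (a : Fin n → ℝ) {f : EuclideanSpace ℝ (Fin n) → ℝ}
    (hf : Differentiable ℝ f) (y : EuclideanSpace ℝ (Fin n)) (i : Fin n) :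
    ∇ (fun y => f (diagMap a y)) y i =
      a i * fderiv ℝ f (diagMap a y) (EuclideanSpace.single i 1) := by
  have h1 : HasFDerivAt (fun y => f (diagMap a y))
      (fderiv ℝ f (diagMap a y) ∘L (diagMap a).toContinuousLinearMap) y :=
    (hf _).hasFDerivAt.comp y (diagMap a).toContinuousLinearMap.hasFDerivAt
  have h2 : diagMap a (EuclideanSpace.single i 1) = a i • EuclideanSpace.single i 1 := by
    ext j
    rw [diagMap_apply]
    by_cases h : j = i <;> simp [h]
  have h3 := inner_gradient_eq_fderiv (fun y => f (diagMap a y)) y (EuclideanSpace.single i 1)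
  rw [h1.fderiv, EuclideanSpace.inner_single_right] at h3
  simpa [h2] using h3

end Rescaling

theorem stmt_14 (n : ℕ) (hn : 1 ≤ n) (a : Fin n → ℝ) (ha : ∀ i, a i > 0)
    (f : EuclideanSpace ℝ (Fin n) → ℝ) (hf : ContDiff ℝ 2 f)
    (hfin : ∀ x : EuclideanSpace ℝ (Fin n),
      f x > Real.sqrt (∑ i, (x i) ^ 2 / (a i) ^ 2))
    (hslope : ∀ xb : EuclideanSpace ℝ (Fin n),
      1 - ∑ i, (a i) ^ 2 * (fderiv ℝ f xb (EuclideanSpace.single i 1)) ^ 2 > 0 ∧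
      f xb - ∑ i, (fderiv ℝ f xb (EuclideanSpace.single i 1)) * xb i ≥ 0)
    (V : ℝ) (hV : V > 0)
    (hvol : ∀ xb : EuclideanSpace ℝ (Fin n),
      volume {w : EuclideanSpace ℝ (Fin n) × ℝ |
          0 ≤ w.2 ∧ (∑ i, (w.1 i) ^ 2 / (a i) ^ 2) ≤ w.2 ^ 2 ∧
          w.2 ≤ f xb + ∑ i, (fderiv ℝ f xb (EuclideanSpace.single i 1)) * (w.1 i - xb i)} =
        ENNReal.ofReal V) :
    ∃ k : ℝ, 0 < k ∧
      V = (∏ i, a i) *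
        (Real.pi ^ ((n : ℝ) / 2) / Real.Gamma ((n : ℝ) / 2 + 1)) *
        k ^ (n + 1) / (n + 1) ∧
      ∀ x : EuclideanSpace ℝ (Fin n),
        f x = Real.sqrt (k ^ 2 + ∑ i, (x i) ^ 2 / (a i) ^ 2) := by
  have : Nonempty (Fin n) := ⟨⟨0, hn⟩⟩
  set T := diagMap (fun i => (a i)⁻¹) with hTdef
  set F : EuclideanSpace ℝ (Fin n) → ℝ := fun y => f (diagMap a y) with hF
  have hprod : 0 < ∏ i, a i := Finset.prod_pos fun i _ => ha i
  have hdet : LinearMap.det T = (∏ i, a i)⁻¹ := by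
    rw [hTdef, det_diagMap, Finset.prod_inv_distrib]
  have hdet0 : LinearMap.det T ≠ 0 := by rw [hdet]; exact (inv_pos.2 hprod).ne'
  have hFd : ContDiff ℝ 2 F := hf.comp (diagMap a).toContinuousLinearMap.contDiff
  have hgrad : ∀ y i, ∇ F y i = a i * fderiv ℝ f (diagMap a y) (EuclideanSpace.single i 1) :=
    gradient_comp_diagMap a (hf.differentiable (by norm_num))
  have hinner : ∀ y x : EuclideanSpace ℝ (Fin n), ⟪∇ F y, T x⟫ =
      ∑ i, fderiv ℝ f (diagMap a y) (EuclideanSpace.single i 1) * x i := by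
    intro y x
    rw [PiLp.inner_apply]
    refine Finset.sum_congr rfl fun i _ => ?_
    rw [hgrad, hTdef, diagMap_apply]
    have := (ha i).ne'
    simp only [RCLike.inner_apply, conj_trivial]
    field_simp
  have hcone : ∀ y, ‖y‖ < F y := by
    intro y
    have h := hfin (diagMap a y)
    rwa [← norm_sq_diagMap_inv, diagMap_inv_diagMap ha, Real.sqrt_sq (norm_nonneg y)] at h
  have hslope' : ∀ y, ‖∇ F y‖ < 1 := by
    intro y
    have h := (hslope (diagMap a y)).1
    rw [← sq_lt_one_iff₀ (norm_nonneg _), EuclideanSpace.real_norm_sq_eq]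
    simp only [hgrad, mul_pow]
    linarith
  have hc : ∀ y, 0 ≤ F y - ⟪∇ F y, y⟫ := by
    intro y
    have h := (hslope (diagMap a y)).2
    rwa [← hinner, hTdef, diagMap_inv_diagMap ha] at h
  have hb := ballConst_pos n
  set r : EuclideanSpace ℝ (Fin n) → ℝ :=
    fun y => (F y - ⟪∇ F y, y⟫) / √(1 - ‖∇ F y‖ ^ 2) with hr
  have hr0 : ∀ y, 0 ≤ r y := fun y => div_nonneg (hc y) (Real.sqrt_nonneg _)
  have hVr : ∀ y, V = (∏ i, a i) * ballConst n * r y ^ (n + 1) / (n + 1) := by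
    intro y
    have h1 := hvol (diagMap a y)
    have h2 := volume_cone_inter_halfSpace hdet0 (hslope' y) (hc y)
    rw [hdet, abs_of_pos (inv_pos.2 hprod), inv_inv] at h2
    have h3 : ∀ x : EuclideanSpace ℝ (Fin n), F y - ⟪∇ F y, y⟫ + ⟪∇ F y, T x⟫ =
        f (diagMap a y) + ∑ i, fderiv ℝ f (diagMap a y) (EuclideanSpace.single i 1) *
          (x i - diagMap a y i) := by
      intro x
      have h5 := hinner y (diagMap a y)
      rw [hTdef, diagMap_inv_diagMap ha] at h5
      rw [hinner, h5]
      simp only [mul_sub, Finset.sum_sub_distrib, hF]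
      ring
    simp only [h3] at h2
    simp only [hTdef, norm_sq_diagMap_inv] at h2
    have h4 := h1.symm.trans h2
    have := hr0 y
    exact (ENNReal.ofReal_eq_ofReal_iff hV.le (by positivity)).1 h4
  have hk0 : r 0 ≠ 0 := by
    intro h
    have := hVr 0
    rw [h] at this
    simp at this
    exact hV.ne' this
  have hk : 0 < r 0 := (hr0 0).lt_of_ne' hk0
  have hrk : ∀ y, r y = r 0 := by
    intro y
    have h := (hVr y).symm.trans (hVr 0)
    refine (pow_left_inj₀ (hr0 y) (hr0 0) n.succ_ne_zero).1 ?_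
    field_simp at h
    exact h
  refine ⟨r 0, hk, ?_, fun x => ?_⟩
  · convert hVr 0 using 4
    rw [ballConst, Real.sqrt_eq_rpow, ← Real.rpow_mul_natCast Real.pi_pos.le]
    congr 2
    ring
  · have hcl : ∀ y, F y - ⟪∇ F y, y⟫ = r 0 * √(1 - ‖∇ F y‖ ^ 2) := fun y => by
      rw [← hrk y, hr]
      exact (div_mul_cancel₀ _ (Real.sqrt_pos.2 (one_sub_norm_sq_pos (hslope' y))).ne').symm
    have h := eq_sqrt_of_clairaut hFd hk hcone hslope' hcl (T x)
    simpa only [hF, hTdef, norm_sq_diagMap_inv, diagMap_diagMap_inv ha] using h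
end

section
/- Let n ≥ 1, let a₁, …, a_{n+1} > 0 and 0 < k < 1, and set ℓ(x,z) = Σ_{i=1}^n xᵢ²/aᵢ² + z²/a_{n+1}². For every point (x̄, z̄) with ℓ(x̄, z̄) = k², the hyperplane tangent at (x̄, z̄) to the ellipsoid ℓ = k², namely Σ_{i=1}^n xᵢx̄ᵢ/aᵢ² + z·z̄/a_{n+1}² = k², cuts off from the solid ellipsoid ℓ(x,z) ≤ 1 a set of smaller volume that is independent of (x̄, z̄): the (n+1)-dimensional Lebesgue measure of {(x,z) ∈ ℝⁿ × ℝ : ℓ(x,z) ≤ 1, Σ_{i=1}^n xᵢx̄ᵢ/aᵢ² + z·z̄/a_{n+1}² ≥ k²} equals a₁⋯a_{n+1} · (π^{n/2} / Γ(n/2 + 1)) · ∫_{k}^{1} (1 − ζ²)^{n/2} dζ, and this is the smaller of the volumes of the two pieces into which the hyperplane divides the solid ellipsoid. -/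
open MeasureTheory

/-- In a finite-dimensional inner product space, the volume of the part of the unit ball cut off by
a half-space `c ≤ ⟪p, w⟫` depends only on `c` and `‖p‖`. -/
lemma volume_unitBall_cap_eq_of_norm_eq {F : Type*} [NormedAddCommGroup F] [InnerProductSpace ℝ F]
    [FiniteDimensional ℝ F] [MeasurableSpace F] [BorelSpace F] {p q : F} (h : ‖p‖ = ‖q‖) (c : ℝ) :
    volume {w : F | ‖w‖ ≤ 1 ∧ c ≤ inner ℝ p w} = volume {w : F | ‖w‖ ≤ 1 ∧ c ≤ inner ℝ q w} := by
  set ρ := Submodule.reflection (ℝ ∙ (p - q))ᗮ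
  have hpq : ρ p = q := Submodule.reflection_sub h
  rw [← ρ.measurePreserving.measure_preimage_emb
    ρ.toMeasurableEquiv.measurableEmbedding {w : F | ‖w‖ ≤ 1 ∧ c ≤ inner ℝ q w}]
  congr 1
  ext w
  simp [← hpq]

/-- The volume of the cap of the unit ball above height `k`, by slicing into horizontal balls. -/
lemma volume_unitBall_cap (n : ℕ) (hn : 1 ≤ n) {k : ℝ} (hk0 : 0 ≤ k) (hk1 : k ≤ 1) :
    volume {w : EuclideanSpace ℝ (Fin n) × ℝ | ‖w.1‖ ^ 2 + w.2 ^ 2 ≤ 1 ∧ k ≤ w.2} =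
      ENNReal.ofReal ((Real.pi ^ ((n : ℝ) / 2) / Real.Gamma ((n : ℝ) / 2 + 1)) *
        ∫ ζ in k..(1 : ℝ), (1 - ζ ^ 2) ^ ((n : ℝ) / 2)) := by
  have : Nonempty (Fin n) := ⟨⟨0, hn⟩⟩
  set C : ℝ := Real.pi ^ ((n : ℝ) / 2) / Real.Gamma ((n : ℝ) / 2 + 1)
  have hmeas : MeasurableSet
      {w : EuclideanSpace ℝ (Fin n) × ℝ | ‖w.1‖ ^ 2 + w.2 ^ 2 ≤ 1 ∧ k ≤ w.2} := by
    rw [Set.ofPred_and]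
    exact (measurableSet_le (by fun_prop) measurable_const).inter
      (measurableSet_le measurable_const measurable_snd)
  have hslice (z : ℝ) : volume ((fun x : EuclideanSpace ℝ (Fin n) => (x, z)) ⁻¹'
      {w : EuclideanSpace ℝ (Fin n) × ℝ | ‖w.1‖ ^ 2 + w.2 ^ 2 ≤ 1 ∧ k ≤ w.2}) =
      (Set.Icc k 1).indicator (fun ζ => ENNReal.ofReal (C * (1 - ζ ^ 2) ^ ((n : ℝ) / 2))) z := by
    by_cases hz : z ∈ Set.Icc k 1
    · have hz' : 0 ≤ 1 - z ^ 2 := by nlinarith [hz.1, hz.2]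
      have hball : (fun x : EuclideanSpace ℝ (Fin n) => (x, z)) ⁻¹'
          {w : EuclideanSpace ℝ (Fin n) × ℝ | ‖w.1‖ ^ 2 + w.2 ^ 2 ≤ 1 ∧ k ≤ w.2} =
          Metric.closedBall 0 √(1 - z ^ 2) := by
        ext x
        simp [Real.le_sqrt (norm_nonneg x) hz', hz.1, le_sub_iff_add_le]
      rw [Set.indicator_of_mem hz, hball, EuclideanSpace.volume_closedBall, Fintype.card_fin,
        ← ENNReal.ofReal_pow (Real.sqrt_nonneg _), ← ENNReal.ofReal_mul (by positivity), mul_comm,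
        Real.sqrt_eq_rpow, Real.sqrt_eq_rpow, ← Real.rpow_natCast, ← Real.rpow_natCast,
        ← Real.rpow_mul hz', ← Real.rpow_mul Real.pi_nonneg, one_div_mul_eq_div]
    · rw [Set.indicator_of_notMem hz]
      convert measure_empty (μ := (volume : Measure (EuclideanSpace ℝ (Fin n))))
      refine Set.eq_empty_of_forall_notMem fun x hx => hz ⟨hx.2, ?_⟩
      nlinarith [hx.1, sq_nonneg ‖x‖]
  rw [Measure.volume_eq_prod, Measure.prod_apply_symm hmeas]
  simp_rw [hslice]
  have hcont : Continuous fun ζ : ℝ => C * (1 - ζ ^ 2) ^ ((n : ℝ) / 2) :=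
    continuous_const.mul (Continuous.rpow_const (by fun_prop) fun _ => Or.inr (by positivity))
  rw [lintegral_indicator measurableSet_Icc, ← intervalIntegral.integral_const_mul,
    intervalIntegral.integral_of_le hk1, ← integral_Icc_eq_integral_Ioc,
    ofReal_integral_eq_lintegral_ofReal]
  · exact hcont.integrableOn_Icc
  · refine (ae_restrict_iff' measurableSet_Icc).2 (ae_of_all _ fun ζ hζ => ?_)
    have : 0 ≤ 1 - ζ ^ 2 := by nlinarith [hζ.1, hζ.2]
    have : 0 < Real.Gamma ((n : ℝ) / 2 + 1) := Real.Gamma_pos_of_pos (by positivity)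
    simp only [Pi.zero_apply]
    positivity

/-- The half-space cap of the unit ball in `ℝⁿ × ℝ` with unnormalised normal vector `(u, v)`. -/
lemma volume_unitBall_halfSpace (n : ℕ) (hn : 1 ≤ n) {k : ℝ} (hk0 : 0 < k) (hk1 : k ≤ 1)
    (u : EuclideanSpace ℝ (Fin n)) (v : ℝ) (huv : ‖u‖ ^ 2 + v ^ 2 = k ^ 2) :
    volume {w : EuclideanSpace ℝ (Fin n) × ℝ |
        ‖w.1‖ ^ 2 + w.2 ^ 2 ≤ 1 ∧ k ^ 2 ≤ inner ℝ u w.1 + v * w.2} =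
      ENNReal.ofReal ((Real.pi ^ ((n : ℝ) / 2) / Real.Gamma ((n : ℝ) / 2 + 1)) *
        ∫ ζ in k..(1 : ℝ), (1 - ζ ^ 2) ^ ((n : ℝ) / 2)) := by
  have hsq (p : WithLp 2 (EuclideanSpace ℝ (Fin n) × ℝ)) :
      ‖p‖ ^ 2 = ‖p.ofLp.1‖ ^ 2 + p.ofLp.2 ^ 2 := by
    rw [WithLp.prod_norm_sq_eq_of_L2, Real.norm_eq_abs, sq_abs]; rfl
  have hnorm : ‖WithLp.toLp 2 (u, v)‖ = ‖WithLp.toLp 2 ((0 : EuclideanSpace ℝ (Fin n)), k)‖ := by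
    rw [← sq_eq_sq₀ (norm_nonneg _) (norm_nonneg _), hsq, hsq]
    simpa using huv
  have hemb : MeasurableEmbedding (@WithLp.ofLp 2 (EuclideanSpace ℝ (Fin n) × ℝ)) :=
    (MeasurableEquiv.toLp 2 (EuclideanSpace ℝ (Fin n) × ℝ)).symm.measurableEmbedding
  have hmp := WithLp.volume_preserving_ofLp (EuclideanSpace ℝ (Fin n)) ℝ
  rw [← volume_unitBall_cap n hn hk0.le hk1, ← hmp.measure_preimage_emb hemb,
    ← hmp.measure_preimage_emb hemb]
  convert volume_unitBall_cap_eq_of_norm_eq hnorm (k ^ 2) using 2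
  · ext w
    simp [← hsq, mul_comm]
  · ext w
    have : k ^ 2 ≤ k * w.ofLp.2 ↔ k ≤ w.ofLp.2 := by rw [sq, mul_le_mul_iff_right₀ hk0]
    simpa [← hsq, mul_comm] using fun _ => this.symm

instance (n : ℕ) :
    (volume : Measure (EuclideanSpace ℝ (Fin n) × ℝ)).IsAddHaarMeasure :=
  inferInstanceAs
    ((volume : Measure (EuclideanSpace ℝ (Fin n))).prod (volume : Measure ℝ)).IsAddHaarMeasure

/-- Stretching the `i`-th axis of `ℝⁿ` by `a i` and the last axis by `b` multiplies volumes by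
`(∏ i, a i) * b`. -/
lemma volume_image_stretch (n : ℕ) (a : Fin n → ℝ) (b : ℝ) (ha : ∀ i, 0 < a i) (hb : 0 < b)
    (s : Set (EuclideanSpace ℝ (Fin n) × ℝ)) :
    volume s = ENNReal.ofReal ((∏ i, a i) * b) * volume
      ((fun w : EuclideanSpace ℝ (Fin n) × ℝ => (WithLp.toLp 2 fun i => a i * w.1 i, b * w.2)) ⁻¹'
        s) := by
  let g : (Fin n → ℝ) →ₗ[ℝ] (Fin n → ℝ) :=
    LinearMap.pi fun i => (a i • LinearMap.id (R := ℝ) (M := ℝ)) ∘ₗ LinearMap.proj i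
  let f : (EuclideanSpace ℝ (Fin n) × ℝ) →ₗ[ℝ] (EuclideanSpace ℝ (Fin n) × ℝ) :=
    ((WithLp.linearEquiv 2 ℝ (Fin n → ℝ)).symm.conj g).prodMap (b • LinearMap.id)
  have hdet : LinearMap.det f = (∏ i, a i) * b := by
    rw [LinearMap.det_prodMap, LinearEquiv.conj_apply, LinearMap.comp_assoc, LinearMap.det_conj,
      LinearMap.det_pi]
    simp
  have hf : (fun w : EuclideanSpace ℝ (Fin n) × ℝ =>
      (WithLp.toLp 2 fun i => a i * w.1 i, b * w.2)) = f := rfl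
  have hpos : 0 < (∏ i, a i) * b := mul_pos (Finset.prod_pos fun i _ => ha i) hb
  rw [hf, Measure.addHaar_preimage_linearMap _ (hdet ▸ hpos.ne'), hdet, ← mul_assoc,
    ← ENNReal.ofReal_mul hpos.le, abs_of_pos (inv_pos.2 hpos), mul_inv_cancel₀ hpos.ne',
    ENNReal.ofReal_one, one_mul]

theorem stmt_17 (n : ℕ) (hn : 1 ≤ n) (a : Fin n → ℝ) (b : ℝ)
    (ha : ∀ i, a i > 0) (hb : b > 0) (k : ℝ) (hk0 : 0 < k) (hk1 : k < 1)
    (xb : EuclideanSpace ℝ (Fin n)) (zb : ℝ)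
    (hon : (∑ i, (xb i) ^ 2 / (a i) ^ 2) + zb ^ 2 / b ^ 2 = k ^ 2) :
    volume {w : EuclideanSpace ℝ (Fin n) × ℝ |
        (∑ i, (w.1 i) ^ 2 / (a i) ^ 2) + w.2 ^ 2 / b ^ 2 ≤ 1 ∧
        k ^ 2 ≤ (∑ i, w.1 i * xb i / (a i) ^ 2) + w.2 * zb / b ^ 2} =
      ENNReal.ofReal ((∏ i, a i) * b *
        (Real.pi ^ ((n : ℝ) / 2) / Real.Gamma ((n : ℝ) / 2 + 1)) *
        ∫ ζ in k..(1 : ℝ), (1 - ζ ^ 2) ^ ((n : ℝ) / 2)) ∧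
    volume {w : EuclideanSpace ℝ (Fin n) × ℝ |
        (∑ i, (w.1 i) ^ 2 / (a i) ^ 2) + w.2 ^ 2 / b ^ 2 ≤ 1 ∧
        k ^ 2 ≤ (∑ i, w.1 i * xb i / (a i) ^ 2) + w.2 * zb / b ^ 2} ≤
    volume {w : EuclideanSpace ℝ (Fin n) × ℝ |
        (∑ i, (w.1 i) ^ 2 / (a i) ^ 2) + w.2 ^ 2 / b ^ 2 ≤ 1 ∧
        (∑ i, w.1 i * xb i / (a i) ^ 2) + w.2 * zb / b ^ 2 ≤ k ^ 2} := by
  constructor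
  · have huv : ‖(WithLp.toLp 2 fun i => xb i / a i : EuclideanSpace ℝ (Fin n))‖ ^ 2 +
        (zb / b) ^ 2 = k ^ 2 := by
      rw [← hon, EuclideanSpace.norm_sq_eq]
      simp [div_pow]
    have hpos : 0 ≤ (∏ i, a i) * b := (mul_pos (Finset.prod_pos fun i _ => ha i) hb).le
    rw [volume_image_stretch n a b ha hb, mul_assoc (_ * b), ENNReal.ofReal_mul hpos,
      ← volume_unitBall_halfSpace n hn hk0 hk1.le _ _ huv]
    congr 2
    ext w
    have h1 (i : Fin n) : (a i * w.1 i) ^ 2 / a i ^ 2 = w.1 i ^ 2 := by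
      have := (ha i).ne'
      field_simp
    have h2 (i : Fin n) : a i * w.1 i * xb i / a i ^ 2 = w.1 i * (xb i / a i) := by
      have := (ha i).ne'
      field_simp
    have h3 : (b * w.2) ^ 2 / b ^ 2 = w.2 ^ 2 := by field_simp
    have h4 : b * w.2 * zb / b ^ 2 = zb / b * w.2 := by field_simp
    simp [h1, h2, h3, h4, EuclideanSpace.norm_sq_eq, PiLp.inner_apply]
  · rw [← Measure.measure_neg]
    refine measure_mono fun w hw => ?_
    simp only [Set.mem_neg, Set.mem_ofPred_eq, Prod.fst_neg, Prod.snd_neg, PiLp.neg_apply, neg_sq,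
      neg_mul, neg_div, Finset.sum_neg_distrib] at hw ⊢
    exact ⟨hw.1, by linarith [hw.2, sq_nonneg k]⟩
end

section
/- Let n ≥ 1, let a₁, …, a_{n+1} > 0, and set ℓ(x,z) = Σ_{i=1}^n xᵢ²/aᵢ² + z²/a_{n+1}². Let K ⊂ ℝⁿ × ℝ be a compact convex set with nonempty interior whose boundary M = ∂K is a C²-surface (there exist an open set A ⊇ M and a twice continuously differentiable g : A → ℝ with M = g⁻¹(0) and with nonvanishing gradient at every point of M), and suppose K is contained in the open solid ellipsoid {(x,z) : ℓ(x,z) < 1}. Suppose there is a constant V > 0 such that for every supporting hyperplane H of K, the intersection of the solid ellipsoid {ℓ ≤ 1} with the closed half-space bounded by H not containing the interior of K has (n+1)-dimensional Lebesgue measure V. Then M = {(x,z) : ℓ(x,z) = k²}, where k ∈ (0,1) is determined by V = a₁⋯a_{n+1} · (π^{n/2} / Γ(n/2 + 1)) · ∫_{k}^{1} (1 − ζ²)^{n/2} dζ. -/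
open MeasureTheory

/-- A closed convex set with nonempty interior whose support function is constant on the unit
sphere is a ball centred at the origin. -/
theorem Convex.eq_closedBall_of_support_const {H : Type*} [NormedAddCommGroup H]
    [InnerProductSpace ℝ H] [CompleteSpace H] [Nontrivial H] {K : Set H} (hconv : Convex ℝ K)
    (hclosed : IsClosed K) (hint : (interior K).Nonempty) {k : ℝ}
    (hle : ∀ u : H, ‖u‖ = 1 → ∀ w ∈ K, inner ℝ u w ≤ k)
    (hex : ∀ u : H, ‖u‖ = 1 → ∃ w ∈ K, inner ℝ u w = k) :
    0 < k ∧ K = Metric.closedBall 0 k := by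
  have hnorm : ∀ w ∈ K, w ≠ 0 → ‖w‖ ≤ k := by
    intro w hw hw0
    have hpos : 0 < ‖w‖ := norm_pos_iff.2 hw0
    have := hle (‖w‖⁻¹ • w) (norm_smul_inv_norm hw0) w hw
    rw [real_inner_smul_left, real_inner_self_eq_norm_sq] at this
    field_simp at this
    exact this
  have hk : 0 < k := by
    by_contra! hk
    have hsub : K ⊆ {0} := by
      intro w hw
      by_contra hw0
      have := hnorm w hw hw0
      have : 0 < ‖w‖ := norm_pos_iff.2 hw0
      linarith
    obtain ⟨x, hx⟩ := hint
    have := interior_mono hsub hx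
    have hne : (nhdsWithin (0 : H) {0}ᶜ).NeBot := Module.punctured_nhds_neBot ℝ H 0
    rw [interior_singleton] at this
    exact this
  refine ⟨hk, Set.Subset.antisymm ?_ ?_⟩
  · intro w hw
    rw [mem_closedBall_zero_iff]
    by_cases hw0 : w = 0
    · simp [hw0, hk.le]
    · exact hnorm w hw hw0
  · intro w hw
    rw [mem_closedBall_zero_iff] at hw
    by_contra hwK
    obtain ⟨f, s, hf, hs⟩ := geometric_hahn_banach_closed_point hconv hclosed hwK
    obtain ⟨x, hx⟩ := hint
    set v := (InnerProductSpace.toDual ℝ H).symm f with hv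
    have hfv : ∀ y, f y = inner ℝ v y := fun y => by simp [hv]
    have hv0 : v ≠ 0 := by
      intro h0
      have h1 := hf x (interior_subset hx)
      simp only [hfv, h0, inner_zero_left] at h1 hs
      linarith
    have hpos : 0 < ‖v‖ := norm_pos_iff.2 hv0
    obtain ⟨y, hy, hyk⟩ := hex (‖v‖⁻¹ • v) (norm_smul_inv_norm hv0)
    rw [real_inner_smul_left] at hyk
    have h1 := (hf y hy).trans hs
    rw [hfv, hfv] at h1
    have h2 := real_inner_le_norm v w
    have h3 : inner ℝ v y = ‖v‖ * k := by rw [← hyk]; field_simp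
    nlinarith

/-- The volume of a cap of the unit ball of `ℝⁿ × ℝ` cut off by a horizontal hyperplane. -/
theorem volume_prod_cap {n : ℕ} (hn : 1 ≤ n) {c : ℝ} (hc : -1 ≤ c) (hc1 : c ≤ 1) :
    volume {p : EuclideanSpace ℝ (Fin n) × ℝ | ‖p.1‖ ^ 2 + p.2 ^ 2 ≤ 1 ∧ c ≤ p.2} =
      ENNReal.ofReal (Real.pi ^ ((n : ℝ) / 2) / Real.Gamma ((n : ℝ) / 2 + 1) *
        ∫ ζ in c..(1 : ℝ), (1 - ζ ^ 2) ^ ((n : ℝ) / 2)) := by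
  have : Nonempty (Fin n) := ⟨⟨0, hn⟩⟩
  have hpow : ∀ {x : ℝ}, 0 ≤ x → √x ^ n = x ^ ((n : ℝ) / 2) := by
    intro x hx
    rw [Real.sqrt_eq_rpow, ← Real.rpow_natCast, ← Real.rpow_mul hx]
    ring_nf
  have hmeas : MeasurableSet
      {p : EuclideanSpace ℝ (Fin n) × ℝ | ‖p.1‖ ^ 2 + p.2 ^ 2 ≤ 1 ∧ c ≤ p.2} := by
    rw [Set.ofPred_and]
    exact ((isClosed_le (by fun_prop) (by fun_prop)).inter
      (isClosed_le (by fun_prop) (by fun_prop))).measurableSet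
  have hcont : Continuous fun ζ : ℝ =>
      Real.pi ^ ((n : ℝ) / 2) / Real.Gamma ((n : ℝ) / 2 + 1) * (1 - ζ ^ 2) ^ ((n : ℝ) / 2) := by
    exact continuous_const.mul
      (Continuous.rpow_const (by fun_prop) fun _ => Or.inr (by positivity))
  have hsq : ∀ y ∈ Set.Icc c 1, 0 ≤ 1 - y ^ 2 := fun y hy => by nlinarith [hy.1, hy.2]
  have hC : 0 ≤ Real.pi ^ ((n : ℝ) / 2) / Real.Gamma ((n : ℝ) / 2 + 1) := by
    have := Real.Gamma_pos_of_pos (s := (n : ℝ) / 2 + 1) (by positivity)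
    positivity
  rw [Measure.volume_eq_prod, Measure.prod_apply_symm hmeas, ← intervalIntegral.integral_const_mul,
    intervalIntegral.integral_of_le hc1, ← integral_Icc_eq_integral_Ioc,
    ofReal_integral_eq_lintegral_ofReal hcont.continuousOn.integrableOn_Icc,
    ← lintegral_indicator measurableSet_Icc]
  · congr 1 with y
    by_cases hy : y ∈ Set.Icc c 1
    · have hset : (fun x : EuclideanSpace ℝ (Fin n) => (x, y)) ⁻¹'
          {p | ‖p.1‖ ^ 2 + p.2 ^ 2 ≤ 1 ∧ c ≤ p.2} = Metric.closedBall 0 √(1 - y ^ 2) := by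
        ext x
        simp only [Set.mem_preimage, Set.mem_ofPred_eq, hy.1, and_true, mem_closedBall_zero_iff]
        rw [Real.le_sqrt (norm_nonneg _) (hsq y hy)]
        constructor <;> intro h <;> linarith
      rw [hset, EuclideanSpace.volume_closedBall, Set.indicator_of_mem hy, Fintype.card_fin,
        ← ENNReal.ofReal_pow (Real.sqrt_nonneg _), hpow (hsq y hy), hpow Real.pi_pos.le,
        ← ENNReal.ofReal_mul' hC, mul_comm]
    · have hset : (fun x : EuclideanSpace ℝ (Fin n) => (x, y)) ⁻¹'
          {p | ‖p.1‖ ^ 2 + p.2 ^ 2 ≤ 1 ∧ c ≤ p.2} = ∅ := by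
        ext x
        simp only [Set.mem_preimage, Set.mem_ofPred_eq, Set.mem_empty_iff_false, iff_false, not_and]
        intro h1 h2
        exact hy ⟨h2, by nlinarith [sq_nonneg ‖x‖]⟩
      rw [hset, measure_empty, Set.indicator_of_notMem hy]
  · filter_upwards [ae_restrict_mem measurableSet_Icc] with y hy
    exact mul_nonneg hC (Real.rpow_nonneg (hsq y hy) _)

theorem measurableSet_closedBall_cap {H : Type*} [NormedAddCommGroup H] [InnerProductSpace ℝ H]
    [MeasurableSpace H] [BorelSpace H] (u : H) (c : ℝ) :
    MeasurableSet {w : H | ‖w‖ ^ 2 ≤ 1 ∧ c ≤ inner ℝ u w} := by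
  rw [Set.ofPred_and]
  exact ((isClosed_le (by fun_prop) (by fun_prop)).inter
    (isClosed_le (by fun_prop) (by fun_prop))).measurableSet

/-- The volume of the cap cut off from the unit ball of `ℝⁿ × ℝ` by a hyperplane at signed distance
`c` from the origin. -/
theorem volume_closedBall_cap {n : ℕ} (hn : 1 ≤ n) {c : ℝ} (hc : -1 ≤ c) (hc1 : c ≤ 1)
    {u : WithLp 2 (EuclideanSpace ℝ (Fin n) × ℝ)} (hu : ‖u‖ = 1) :
    volume {w : WithLp 2 (EuclideanSpace ℝ (Fin n) × ℝ) | ‖w‖ ^ 2 ≤ 1 ∧ c ≤ inner ℝ u w} =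
      ENNReal.ofReal (Real.pi ^ ((n : ℝ) / 2) / Real.Gamma ((n : ℝ) / 2 + 1) *
        ∫ ζ in c..(1 : ℝ), (1 - ζ ^ 2) ^ ((n : ℝ) / 2)) := by
  set e : WithLp 2 (EuclideanSpace ℝ (Fin n) × ℝ) := WithLp.toLp 2 (0, 1) with he
  have henorm : ‖u‖ = ‖e‖ := by
    rw [hu, he, WithLp.prod_norm_eq_of_L2]
    simp
  set R := (ℝ ∙ (u - e))ᗮ.reflection with hR
  have hRu : R u = e := Submodule.reflection_sub henorm
  have hpre : {w : WithLp 2 (EuclideanSpace ℝ (Fin n) × ℝ) | ‖w‖ ^ 2 ≤ 1 ∧ c ≤ inner ℝ u w} =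
      R ⁻¹' {w | ‖w‖ ^ 2 ≤ 1 ∧ c ≤ inner ℝ e w} := by
    ext w
    simp only [Set.mem_preimage, Set.mem_ofPred_eq, LinearIsometryEquiv.norm_map, ← hRu,
      LinearIsometryEquiv.inner_map_map]
  rw [hpre,
    R.measurePreserving.measure_preimage (measurableSet_closedBall_cap e c).nullMeasurableSet,
    ← (WithLp.volume_preserving_toLp (EuclideanSpace ℝ (Fin n)) ℝ).measure_preimage
      (measurableSet_closedBall_cap e c).nullMeasurableSet, ← volume_prod_cap hn hc hc1]
  congr 1
  ext p
  simp [WithLp.prod_norm_sq_eq_of_L2, he, WithLp.prod_inner_apply]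

theorem integral_one_sub_sq_rpow_strictAntiOn (s : ℝ) (hs : 0 ≤ s) :
    StrictAntiOn (fun c : ℝ => ∫ ζ in c..(1 : ℝ), (1 - ζ ^ 2) ^ s) (Set.Icc (-1) 1) := by
  intro c hc d hd hcd
  have hcont : Continuous fun ζ : ℝ => (1 - ζ ^ 2) ^ s :=
    Continuous.rpow_const (by fun_prop) fun _ => Or.inr hs
  have hpos : 0 < ∫ ζ in c..d, (1 - ζ ^ 2) ^ s := by
    refine intervalIntegral.intervalIntegral_pos_of_pos_on (hcont.intervalIntegrable _ _) ?_ hcd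
    intro x hx
    apply Real.rpow_pos_of_pos
    nlinarith [hx.1, hx.2, hc.1, hd.2]
  have := intervalIntegral.integral_add_adjacent_intervals (hcont.intervalIntegrable c d)
    (hcont.intervalIntegrable (μ := volume) d 1)
  dsimp only
  linarith

/-- The rescaling that carries the solid ellipsoid with semi-axes `a i` and `b` to the Euclidean
unit ball. -/
theorem exists_ellipsoid_rescaling {n : ℕ} {a : Fin n → ℝ} {b : ℝ} (ha : ∀ i, 0 < a i)
    (hb : 0 < b) :
    ∃ L : (EuclideanSpace ℝ (Fin n) × ℝ) ≃L[ℝ] WithLp 2 (EuclideanSpace ℝ (Fin n) × ℝ),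
      (∀ w, ‖L w‖ ^ 2 = (∑ i, (w.1 i) ^ 2 / (a i) ^ 2) + w.2 ^ 2 / b ^ 2) ∧
      ∀ s, MeasurableSet s → volume (L ⁻¹' s) = ENNReal.ofReal ((∏ i, a i) * b) * volume s := by
  let P : (Fin n → ℝ) ≃ₗ[ℝ] (Fin n → ℝ) := LinearEquiv.piCongrRight fun i =>
    LinearEquiv.smulOfNeZero ℝ ℝ (a i)⁻¹ (inv_ne_zero (ha i).ne')
  let A : EuclideanSpace ℝ (Fin n) ≃ₗ[ℝ] EuclideanSpace ℝ (Fin n) :=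
    (WithLp.linearEquiv 2 ℝ (Fin n → ℝ)).trans
      (P.trans (WithLp.linearEquiv 2 ℝ (Fin n → ℝ)).symm)
  let D : (EuclideanSpace ℝ (Fin n) × ℝ) ≃ₗ[ℝ] (EuclideanSpace ℝ (Fin n) × ℝ) :=
    A.prodCongr (LinearEquiv.smulOfNeZero ℝ ℝ b⁻¹ (inv_ne_zero hb.ne'))
  have hprod : 0 < (∏ i, a i) * b := mul_pos (Finset.prod_pos fun i _ => ha i) hb
  have hP : LinearMap.det (P : (Fin n → ℝ) →ₗ[ℝ] (Fin n → ℝ)) = ∏ i, (a i)⁻¹ := by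
    have : (P : (Fin n → ℝ) →ₗ[ℝ] (Fin n → ℝ)) =
      LinearMap.pi fun i => ((a i)⁻¹ • LinearMap.id).comp (LinearMap.proj i) := by
        ext; simp [P]
    rw [this, LinearMap.det_pi]
    simp
  have hA : LinearMap.det (A : EuclideanSpace ℝ (Fin n) →ₗ[ℝ] EuclideanSpace ℝ (Fin n)) =
      ∏ i, (a i)⁻¹ := by
    rw [← hP]
    exact LinearMap.det_conj (P : (Fin n → ℝ) →ₗ[ℝ] (Fin n → ℝ))
      (WithLp.linearEquiv 2 ℝ (Fin n → ℝ)).symm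
  have hD : LinearMap.det (D : (EuclideanSpace ℝ (Fin n) × ℝ) →ₗ[ℝ]
      (EuclideanSpace ℝ (Fin n) × ℝ)) = ((∏ i, a i) * b)⁻¹ := by
    have : (D : (EuclideanSpace ℝ (Fin n) × ℝ) →ₗ[ℝ] (EuclideanSpace ℝ (Fin n) × ℝ)) =
      LinearMap.prodMap (A : EuclideanSpace ℝ (Fin n) →ₗ[ℝ] EuclideanSpace ℝ (Fin n))
        (b⁻¹ • LinearMap.id) := rfl
    rw [this, LinearMap.det_prodMap, hA]
    simp [mul_comm]
  refine ⟨D.toContinuousLinearEquiv.trans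
    (WithLp.prodContinuousLinearEquiv 2 ℝ (EuclideanSpace ℝ (Fin n)) ℝ).symm, ?_, ?_⟩
  · intro w
    have h1 : ∀ i, (WithLp.toLp 2 (D w)).fst i = (a i)⁻¹ * w.1 i := fun i => rfl
    have h2 : (WithLp.toLp 2 (D w)).snd = b⁻¹ * w.2 := rfl
    change ‖WithLp.toLp 2 (D w)‖ ^ 2 = _
    rw [WithLp.prod_norm_sq_eq_of_L2]
    simp only [EuclideanSpace.real_norm_sq_eq, h1, h2, Real.norm_eq_abs, sq_abs]
    simp only [mul_pow, inv_pow, div_eq_inv_mul]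
  · intro s hs
    rw [← (WithLp.volume_preserving_toLp (EuclideanSpace ℝ (Fin n)) ℝ).measure_preimage
      hs.nullMeasurableSet]
    have : (volume : Measure (EuclideanSpace ℝ (Fin n) × ℝ)).IsAddHaarMeasure := by
      rw [Measure.volume_eq_prod]; infer_instance
    have := Measure.addHaar_preimage_linearMap (volume : Measure (EuclideanSpace ℝ (Fin n) × ℝ))
      (f := (D : (EuclideanSpace ℝ (Fin n) × ℝ) →ₗ[ℝ] (EuclideanSpace ℝ (Fin n) × ℝ)))
      (by rw [hD]; exact (inv_pos.2 hprod).ne') (WithLp.toLp 2 ⁻¹' s)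
    rw [hD, inv_inv, abs_of_pos hprod] at this
    exact this

theorem stmt_18 (n : ℕ) (hn : 1 ≤ n) (a : Fin n → ℝ) (b : ℝ)
    (ha : ∀ i, a i > 0) (hb : b > 0)
    (K : Set (EuclideanSpace ℝ (Fin n) × ℝ))
    (hKcomp : IsCompact K) (hKconv : Convex ℝ K)
    (hKint : (interior K).Nonempty)
    (hsmooth : ∃ (A : Set (EuclideanSpace ℝ (Fin n) × ℝ))
        (g : EuclideanSpace ℝ (Fin n) × ℝ → ℝ),
      IsOpen A ∧ frontier K ⊆ A ∧ ContDiffOn ℝ 2 g A ∧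
      frontier K = {w ∈ A | g w = 0} ∧
      ∀ w ∈ frontier K, fderiv ℝ g w ≠ 0)
    (hKsub : K ⊆ {w : EuclideanSpace ℝ (Fin n) × ℝ |
      (∑ i, (w.1 i) ^ 2 / (a i) ^ 2) + w.2 ^ 2 / b ^ 2 < 1})
    (V : ℝ) (hV : V > 0)
    (hsupp : ∀ (φ : (EuclideanSpace ℝ (Fin n) × ℝ) →L[ℝ] ℝ) (c : ℝ),
      φ ≠ 0 → (∀ w ∈ K, φ w ≤ c) → (∃ w ∈ K, φ w = c) →
      volume {w : EuclideanSpace ℝ (Fin n) × ℝ |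
          (∑ i, (w.1 i) ^ 2 / (a i) ^ 2) + w.2 ^ 2 / b ^ 2 ≤ 1 ∧ c ≤ φ w} =
        ENNReal.ofReal V) :
    ∃ k : ℝ, 0 < k ∧ k < 1 ∧
      V = (∏ i, a i) * b *
        (Real.pi ^ ((n : ℝ) / 2) / Real.Gamma ((n : ℝ) / 2 + 1)) *
        (∫ ζ in k..(1 : ℝ), (1 - ζ ^ 2) ^ ((n : ℝ) / 2)) ∧
      frontier K = {w : EuclideanSpace ℝ (Fin n) × ℝ |
        (∑ i, (w.1 i) ^ 2 / (a i) ^ 2) + w.2 ^ 2 / b ^ 2 = k ^ 2} := by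
  obtain ⟨L, hLnorm, hLvol⟩ := exists_ellipsoid_rescaling ha hb
  have hC : 0 < Real.pi ^ ((n : ℝ) / 2) / Real.Gamma ((n : ℝ) / 2 + 1) := by
    have := Real.Gamma_pos_of_pos (s := (n : ℝ) / 2 + 1) (by positivity)
    positivity
  have hprod : 0 < (∏ i, a i) * b := mul_pos (Finset.prod_pos fun i _ => ha i) hb
  have hanti := integral_one_sub_sq_rpow_strictAntiOn ((n : ℝ) / 2) (by positivity)
  have hKne : K.Nonempty := hKint.mono interior_subset
  have hlt : ∀ w ∈ K, ‖L w‖ < 1 := by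
    intro w hw
    have : ‖L w‖ ^ 2 < 1 := by rw [hLnorm]; exact hKsub hw
    nlinarith [norm_nonneg (L w)]
  have hcap : ∀ u : WithLp 2 (EuclideanSpace ℝ (Fin n) × ℝ), ‖u‖ = 1 →
      ∃ c ∈ Set.Ioo (-1 : ℝ) 1, (∀ w ∈ L '' K, inner ℝ u w ≤ c) ∧
        (∃ w ∈ L '' K, inner ℝ u w = c) ∧
        V = (∏ i, a i) * b * (Real.pi ^ ((n : ℝ) / 2) / Real.Gamma ((n : ℝ) / 2 + 1)) *
          (∫ ζ in c..(1 : ℝ), (1 - ζ ^ 2) ^ ((n : ℝ) / 2)) := by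
    intro u hu
    obtain ⟨w₀, hw₀, hmax⟩ := hKcomp.exists_isMaxOn hKne
      (f := fun w => inner ℝ u (L w)) (by fun_prop)
    have habs : |inner ℝ u (L w₀)| < 1 := by
      have := abs_real_inner_le_norm u (L w₀)
      rw [hu, one_mul] at this
      exact this.trans_lt (hlt w₀ hw₀)
    obtain ⟨hc, hc1⟩ := abs_lt.1 habs
    refine ⟨inner ℝ u (L w₀), ⟨hc, hc1⟩, ?_, ⟨_, ⟨w₀, hw₀, rfl⟩, rfl⟩, ?_⟩
    · rintro _ ⟨w, hw, rfl⟩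
      exact hmax hw
    let φ : (EuclideanSpace ℝ (Fin n) × ℝ) →L[ℝ] ℝ := (innerSL ℝ u).comp L.toContinuousLinearMap
    have hφ : φ ≠ 0 := by
      intro h0
      have : φ (L.symm u) = 1 := by simp [φ, hu]
      simp [h0] at this
    have hvol := hsupp φ (inner ℝ u (L w₀)) hφ (fun w hw => hmax hw) ⟨w₀, hw₀, rfl⟩
    have hpre := hLvol _ (measurableSet_closedBall_cap u (inner ℝ u (L w₀)))
    rw [volume_closedBall_cap hn hc.le hc1.le hu, ← ENNReal.ofReal_mul hprod.le] at hpre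
    have hset : L ⁻¹' {w | ‖w‖ ^ 2 ≤ 1 ∧ inner ℝ u (L w₀) ≤ inner ℝ u w} =
        {w : EuclideanSpace ℝ (Fin n) × ℝ | (∑ i, (w.1 i) ^ 2 / (a i) ^ 2) + w.2 ^ 2 / b ^ 2 ≤ 1 ∧
          inner ℝ u (L w₀) ≤ φ w} := by
      ext w
      simp only [Set.mem_preimage, Set.mem_ofPred_eq, hLnorm]
      rfl
    rw [hset, hvol] at hpre
    have hI := hanti ⟨hc.le, hc1.le⟩ ⟨by norm_num, le_rfl⟩ hc1
    simp only [intervalIntegral.integral_same] at hI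
    rw [ENNReal.ofReal_eq_ofReal_iff hV.le (by positivity)] at hpre
    rw [hpre]
    ring
  obtain ⟨e, he⟩ := exists_norm_eq (WithLp 2 (EuclideanSpace ℝ (Fin n) × ℝ)) zero_le_one
  obtain ⟨k, hk, -, -, hVk⟩ := hcap e he
  have hcap' : ∀ u : WithLp 2 (EuclideanSpace ℝ (Fin n) × ℝ), ‖u‖ = 1 →
      (∀ w ∈ L '' K, inner ℝ u w ≤ k) ∧ ∃ w ∈ L '' K, inner ℝ u w = k := by
    intro u hu
    obtain ⟨c, hc, hle, hex, hVc⟩ := hcap u hu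
    have hck : c = k := by
      apply hanti.injOn (Set.Ioo_subset_Icc_self hc) (Set.Ioo_subset_Icc_self hk)
      rw [hVk] at hVc
      exact (mul_left_cancel₀ (mul_pos hprod hC).ne' hVc).symm
    exact hck ▸ ⟨hle, hex⟩
  have hconv : Convex ℝ (L '' K) := hKconv.is_linear_image L.toLinearMap.isLinear
  have hint : (interior (L '' K)).Nonempty := by
    rw [← L.coe_toHomeomorph, ← L.toHomeomorph.image_interior]
    exact hKint.image _
  obtain ⟨hk0, hball⟩ := hconv.eq_closedBall_of_support_const
    (hKcomp.image L.continuous).isClosed hint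
    (fun u hu => (hcap' u hu).1) (fun u hu => (hcap' u hu).2)
  refine ⟨k, hk0, hk.2, hVk, ?_⟩
  have hfr : L '' frontier K = Metric.sphere 0 k := by
    rw [← frontier_closedBall _ hk0.ne', ← hball]
    exact L.toHomeomorph.image_frontier K
  ext w
  rw [← L.injective.mem_set_image, hfr, mem_sphere_zero_iff_norm, Set.mem_ofPred_eq, ← hLnorm,
    sq_eq_sq₀ (norm_nonneg _) hk0.le]
end
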